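/- arXiv:1810.06271 — 2 statements merged into one kernel-verified Lean document; each statement's English description precedes it below -/
import Mathlib

section
/- Let M be an n×n real random matrix with i.i.d. standard Gaussian entries. Then the expected value of |det(M)| equals √(2^n)·Γ((n+1)/2)/√π. -/
open MeasureTheory ProbabilityTheory

/-- The standard Gaussian measure on `n × m` real matrices (viewed as `Fin n → Fin m → ℝ`):
all entries i.i.d. `N(0,1)`. -/
noncomputable def stdGaussianMatrix (n m : ℕ) :
    Measure (Fin n → Fin m → ℝ) :=
  Measure.pi fun _ => Measure.pi fun _ => gaussianReal 0 1

noncomputable def gvec (n : ℕ) : Measure (Fin n → ℝ) := Measure.pi fun _ => gaussianReal 0 1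

instance (n : ℕ) : IsProbabilityMeasure (gvec n) := by unfold gvec; infer_instance

lemma gvec_density (n : ℕ) : gvec n = volume.withDensity (fun x => ENNReal.ofReal
    ((Real.sqrt (2 * Real.pi))⁻¹ ^ n * Real.exp (-(∑ i, x i ^ 2) / 2))) := by
  induction n with
  | zero =>
    simp only [gvec, Finset.univ_eq_empty, Finset.sum_empty, pow_zero, neg_zero, zero_div,
      Real.exp_zero, mul_one, ENNReal.ofReal_one]
    rw [withDensity_const, one_smul, volume_pi, Measure.pi_of_empty, Measure.pi_of_empty]
  | succ n ih =>
    have h1 := (measurePreserving_piFinSuccAbove (fun _ : Fin (n+1) => gaussianReal 0 1) 0).symm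
    have h2 := (volume_preserving_piFinSuccAbove (fun _ : Fin (n+1) => ℝ) 0).symm
    ext s hs
    rw [gvec, ← h1.measure_preimage hs.nullMeasurableSet, withDensity_apply _ hs,
      ← h2.setLIntegral_comp_preimage hs (by fun_prop)]
    change ((gaussianReal 0 1).prod (gvec n)) _ = _
    rw [ih, gaussianReal_of_var_ne_zero _ one_ne_zero, prod_withDensity (by fun_prop) (by fun_prop),
      withDensity_apply _ (h2.measurable hs)]
    refine lintegral_congr fun z => ?_
    simp only [gaussianPDF, gaussianPDFReal]
    rw [← ENNReal.ofReal_mul (by positivity)]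
    congr 1
    simp [Fin.sum_univ_succ, MeasurableEquiv.piFinSuccAbove_symm_apply, Fin.insertNthEquiv]
    rw [pow_succ (_ * _) n, add_div, Real.exp_add]
    ring_nf

lemma integral_norm_gvec (n : ℕ) (h : ℝ → ℝ) :
    ∫ x, h ‖WithLp.toLp 2 x‖ ∂(gvec (n+1)) =
      ((n+1) * (volume : Measure (EuclideanSpace ℝ (Fin (n+1)))).real (Metric.ball 0 1) *
      (Real.sqrt (2 * Real.pi))⁻¹ ^ (n+1)) *
      ∫ r in Set.Ioi (0:ℝ), r ^ n * (Real.exp (- r ^ 2 / 2) * h r) := by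
  rw [gvec_density, integral_withDensity_eq_integral_toReal_smul (by fun_prop)
    (by simp)]
  have h3 := (PiLp.volume_preserving_toLp (Fin (n+1))).integral_comp
    (MeasurableEquiv.toLp 2 (Fin (n+1) → ℝ)).measurableEmbedding
    (fun y : EuclideanSpace ℝ (Fin (n+1)) => ((Real.sqrt (2 * Real.pi))⁻¹ ^ (n+1) * Real.exp (-‖y‖ ^ 2 / 2)) * h ‖y‖)
  have h4 := integral_fun_norm_addHaar (volume : Measure (EuclideanSpace ℝ (Fin (n+1))))
    (fun r => ((Real.sqrt (2 * Real.pi))⁻¹ ^ (n+1) * Real.exp (-r ^ 2 / 2)) * h r)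
  rw [h4] at h3
  simp only [EuclideanSpace.real_norm_sq_eq] at h3
  refine Eq.trans ?_ (h3.trans ?_)
  · refine integral_congr_ae (.of_forall fun x => ?_)
    simp only [smul_eq_mul]
    rw [ENNReal.toReal_ofReal (by positivity)]
  · simp only [finrank_euclideanSpace, Fintype.card_fin, nsmul_eq_mul, smul_eq_mul,
      Nat.add_sub_cancel]
    rw [mul_assoc ((n+1 : ℝ) * _)]
    push_cast
    rw [mul_assoc]
    have e : (fun r : ℝ => r ^ n * ((Real.sqrt (2 * Real.pi))⁻¹ ^ (n+1) * Real.exp (-r ^ 2 / 2) * h r)) =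
        fun r => (Real.sqrt (2 * Real.pi))⁻¹ ^ (n+1) * (r ^ n * (Real.exp (-r ^ 2 / 2) * h r)) := by
      funext r
      ring
    rw [e, integral_const_mul]

lemma J_eq (k : ℕ) : ∫ r in Set.Ioi (0:ℝ), r ^ k * Real.exp (- r ^ 2 / 2) =
    (1/2 : ℝ) ^ (-((k:ℝ)+1)/2) * (1/2) * Real.Gamma (((k:ℝ)+1)/2) := by
  have := integral_rpow_mul_exp_neg_mul_rpow (p := 2) (q := k) (b := 1/2) (by norm_num)
    (by have : (0:ℝ) ≤ k := by positivity
        linarith) (by norm_num)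
  rw [← this]
  refine setIntegral_congr_fun measurableSet_Ioi fun r _ => ?_
  simp only [Real.rpow_natCast]
  norm_num
  left; ring

lemma integral_norm_gvec' (n : ℕ) :
    ∫ x, ‖WithLp.toLp 2 x‖ ∂(gvec (n+1)) =
      Real.sqrt 2 * Real.Gamma (((n:ℝ)+2)/2) / Real.Gamma (((n:ℝ)+1)/2) := by
  have h0 := integral_norm_gvec n (fun _ => 1)
  have h1 := integral_norm_gvec n (fun r => r)
  simp only [integral_const, probReal_univ, smul_eq_mul, mul_one] at h0
  have e : ∀ r : ℝ, r ^ n * (Real.exp (- r ^ 2 / 2) * r) = r ^ (n+1) * Real.exp (- r ^ 2 / 2) := by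
    intro r; ring
  simp only [e] at h1
  rw [h1]
  rw [J_eq] at h0 ⊢
  generalize ((n:ℝ)+1) * (volume : Measure (EuclideanSpace ℝ (Fin (n+1)))).real (Metric.ball 0 1) *
      (Real.sqrt (2 * Real.pi))⁻¹ ^ (n+1) = c at *
  have hG : 0 < Real.Gamma (((n:ℝ)+1)/2) := Real.Gamma_pos_of_pos (by positivity)
  rw [eq_div_iff hG.ne']
  have e2 : (1/2 : ℝ) ^ (-(((n+1:ℕ):ℝ)+1)/2) = (1/2 : ℝ) ^ (-((n:ℝ)+1)/2) * Real.sqrt 2 := by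
    have : (-(((n+1:ℕ):ℝ)+1)/2) = (-((n:ℝ)+1)/2) + (-(1/2)) := by push_cast; ring
    rw [this, Real.rpow_add (by norm_num), Real.sqrt_eq_rpow]
    congr 1
    rw [Real.rpow_neg (by norm_num), ← Real.inv_rpow (by norm_num)]
    norm_num
  rw [e2]
  have e3 : (((n+1:ℕ):ℝ)+1)/2 = ((n:ℝ)+2)/2 := by push_cast; ring
  rw [e3]
  linear_combination (-Real.sqrt 2 * Real.Gamma (((n:ℝ)+2)/2)) * h0

lemma lintegral_norm_gvec (n : ℕ) :
    ∫⁻ x, ENNReal.ofReal ‖WithLp.toLp 2 x‖ ∂(gvec (n+1)) =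
      ENNReal.ofReal (Real.sqrt 2 * Real.Gamma (((n:ℝ)+2)/2) / Real.Gamma (((n:ℝ)+1)/2)) := by
  rw [← integral_norm_gvec', ofReal_integral_eq_lintegral_ofReal]
  · by_contra hc
    have := integral_norm_gvec' n
    rw [integral_undef hc] at this
    have h1 : 0 < Real.Gamma (((n:ℝ)+1)/2) := Real.Gamma_pos_of_pos (by positivity)
    have h2 : 0 < Real.Gamma (((n:ℝ)+2)/2) := Real.Gamma_pos_of_pos (by positivity)
    have : 0 < Real.sqrt 2 * Real.Gamma (((n:ℝ)+2)/2) / Real.Gamma (((n:ℝ)+1)/2) := by positivity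
    linarith
  · exact .of_forall fun x => norm_nonneg _

/-- rotation invariance -/
lemma mp_rot (n : ℕ) (f : EuclideanSpace ℝ (Fin n) ≃ₗᵢ[ℝ] EuclideanSpace ℝ (Fin n)) :
    MeasurePreserving (fun x : Fin n → ℝ => WithLp.ofLp (f (WithLp.toLp 2 x))) (gvec n) (gvec n) := by
  have hm : Measurable (fun x : Fin n → ℝ => WithLp.ofLp (f (WithLp.toLp 2 x))) := by fun_prop
  have a : MeasurePreserving (WithLp.toLp 2 : (Fin n → ℝ) → _) (gvec n)
      (stdGaussian (EuclideanSpace ℝ (Fin n))) := ⟨by fun_prop, map_pi_eq_stdGaussian⟩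
  have b : MeasurePreserving f (stdGaussian (EuclideanSpace ℝ (Fin n))) 
      (stdGaussian (EuclideanSpace ℝ (Fin n))) := ⟨by fun_prop, stdGaussian_map f⟩
  have c : MeasurePreserving (WithLp.ofLp : EuclideanSpace ℝ (Fin n) → _)
      (stdGaussian (EuclideanSpace ℝ (Fin n))) (gvec n) := by
    refine ⟨by fun_prop, ?_⟩
    rw [← a.map_eq, Measure.map_map (by fun_prop) (by fun_prop)]
    exact Measure.map_id
  exact c.comp (b.comp a)

lemma det_rot (n : ℕ) (f : EuclideanSpace ℝ (Fin n) ≃ₗᵢ[ℝ] EuclideanSpace ℝ (Fin n))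
    (R : Fin n → Fin n → ℝ) :
    |(Matrix.of fun i => WithLp.ofLp (f (WithLp.toLp 2 (R i)))).det| = |(Matrix.of R).det| := by
  have key : ∀ v : Fin n → EuclideanSpace ℝ (Fin n),
      (EuclideanSpace.basisFun (Fin n) ℝ).toBasis.det v = (Matrix.of fun i => WithLp.ofLp (v i)).det := by
    intro v
    rw [Module.Basis.det_apply, ← Matrix.det_transpose]
    congr 1
  have := Module.Basis.det_comp (EuclideanSpace.basisFun (Fin n) ℝ).toBasis
    (f.toLinearEquiv : EuclideanSpace ℝ (Fin n) →ₗ[ℝ] EuclideanSpace ℝ (Fin n)) (fun i => WithLp.toLp 2 (R i))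
  rw [key, key] at this
  have hd : |LinearMap.det (f.toLinearEquiv : EuclideanSpace ℝ (Fin n) →ₗ[ℝ] EuclideanSpace ℝ (Fin n))| = 1 := by
    have h1 := Module.Basis.det_comp (EuclideanSpace.basisFun (Fin n) ℝ).toBasis
      (f.toLinearEquiv : EuclideanSpace ℝ (Fin n) →ₗ[ℝ] EuclideanSpace ℝ (Fin n))
      (EuclideanSpace.basisFun (Fin n) ℝ).toBasis
    rw [Module.Basis.det_self, mul_one] at h1
    rw [← h1, ← Real.norm_eq_abs]
    have h2 := OrthonormalBasis.det_to_matrix_orthonormalBasis (EuclideanSpace.basisFun (Fin n) ℝ)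
      ((EuclideanSpace.basisFun (Fin n) ℝ).map f)
    rw [← h2]
    congr 2
  simp only [Function.comp_def] at this
  calc _ = _ := congrArg abs this
    _ = _ := by rw [abs_mul, hd, one_mul]

lemma meas_det {α : Type*} [MeasurableSpace α] (n : ℕ) (F : α → Fin n → Fin n → ℝ)
    (hF : Measurable F) : Measurable fun a => |(Matrix.of (F a)).det| := by
  have : Continuous fun M : Fin n → Fin n → ℝ => |(Matrix.of M).det| :=
    (Continuous.matrix_det (A := fun M : Fin n → Fin n → ℝ => Matrix.of M) continuous_id).abs
  exact this.measurable.comp hF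

lemma meas_cons (n : ℕ) (g : Fin (n+1) → ℝ) : Measurable fun R : Fin n → Fin (n+1) → ℝ =>
    (Fin.cons g R : Fin (n+1) → Fin (n+1) → ℝ) := by
  refine measurable_pi_iff.2 fun i => ?_
  refine Fin.cases ?_ (fun i => ?_) i
  · exact measurable_const
  · exact measurable_pi_apply i

lemma mp_tail (n : ℕ) : MeasurePreserving (fun (x : Fin (n+1) → ℝ) (j : Fin n) => x j.succ)
    (gvec (n+1)) (gvec n) := by
  have h1 := (measurePreserving_piFinSuccAbove (fun _ : Fin (n+1) => gaussianReal 0 1) 0)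
  exact (measurePreserving_snd (μ := gaussianReal 0 1) (ν := gvec n)).comp h1

lemma inner_e0 (n : ℕ) :
    ∫⁻ R : Fin n → Fin (n+1) → ℝ, ENNReal.ofReal
      |(Matrix.of (Fin.cons (Pi.single 0 1) R : Fin (n+1) → Fin (n+1) → ℝ)).det| ∂(stdGaussianMatrix n (n+1)) =
    ∫⁻ R, ENNReal.ofReal |(Matrix.of R).det| ∂(stdGaussianMatrix n n) := by
  have hp : MeasurePreserving (fun (R : Fin n → Fin (n+1) → ℝ) i (j : Fin n) => R i j.succ)
      (stdGaussianMatrix n (n+1)) (stdGaussianMatrix n n) :=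
    measurePreserving_pi (fun _ => gvec (n+1)) (fun _ => gvec n) (fun _ => mp_tail n)
  rw [← hp.lintegral_comp (meas_det n (fun M => M) measurable_id).ennreal_ofReal]
  refine lintegral_congr fun R => ?_
  congr 2
  rw [Matrix.det_succ_row_zero, Fin.sum_univ_succ]
  simp
  rfl

lemma inner_g (n : ℕ) (g : Fin (n+1) → ℝ) :
    ∫⁻ R : Fin n → Fin (n+1) → ℝ, ENNReal.ofReal
      |(Matrix.of (Fin.cons g R : Fin (n+1) → Fin (n+1) → ℝ)).det| ∂(stdGaussianMatrix n (n+1)) =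
    ENNReal.ofReal ‖WithLp.toLp 2 g‖ * 
      ∫⁻ R, ENNReal.ofReal |(Matrix.of R).det| ∂(stdGaussianMatrix n n) := by
  set N := ‖WithLp.toLp 2 g‖ with hN
  let v : EuclideanSpace ℝ (Fin (n+1)) := WithLp.toLp 2 (N • Pi.single 0 1)
  have hv : ‖v‖ = ‖WithLp.toLp 2 g‖ := by
    simp only [v, WithLp.toLp_smul, norm_smul]
    simp [N]
  let f := Submodule.reflection (Submodule.span ℝ {v - WithLp.toLp 2 g})ᗮ
  have hf : f v = WithLp.toLp 2 g := Submodule.reflection_sub hv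
  have hp : MeasurePreserving (fun (R : Fin n → Fin (n+1) → ℝ) i => WithLp.ofLp (f (WithLp.toLp 2 (R i))))
      (stdGaussianMatrix n (n+1)) (stdGaussianMatrix n (n+1)) :=
    measurePreserving_pi (fun _ => gvec (n+1)) (fun _ => gvec (n+1)) (fun _ => mp_rot (n+1) f)
  rw [← hp.lintegral_comp (meas_det _ _ (meas_cons n g)).ennreal_ofReal, ← inner_e0,
    ← lintegral_const_mul _ (meas_det _ _ (meas_cons n _)).ennreal_ofReal]
  refine lintegral_congr fun R => ?_
  rw [← ENNReal.ofReal_mul (norm_nonneg _)]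
  congr 1
  have h1 := det_rot (n+1) f (Fin.cons (N • Pi.single 0 1) R)
  have h2 : (fun i => WithLp.ofLp (f (WithLp.toLp 2
      ((Fin.cons (N • Pi.single 0 1) R : Fin (n+1) → Fin (n+1) → ℝ) i)))) =
      Fin.cons g (fun i => WithLp.ofLp (f (WithLp.toLp 2 (R i)))) := by
    funext i
    refine Fin.cases ?_ (fun i => ?_) i
    · change WithLp.ofLp (f v) = _
      rw [hf]; rfl
    · rfl
  rw [h2] at h1
  rw [h1, Matrix.det_succ_row_zero, Matrix.det_succ_row_zero, Fin.sum_univ_succ, Fin.sum_univ_succ]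
  simp [abs_mul]
  rw [abs_of_nonneg (norm_nonneg _ : 0 ≤ N)]
  rfl

lemma main_l (n : ℕ) : ∫⁻ M, ENNReal.ofReal |(Matrix.of M).det| ∂(stdGaussianMatrix n n)
      = ENNReal.ofReal (Real.sqrt (2 ^ n) * Real.Gamma ((n + 1) / 2) / Real.sqrt Real.pi) := by
  induction n with
  | zero => 
    have : Real.sqrt Real.pi ≠ 0 := by positivity
    simp [stdGaussianMatrix, Real.Gamma_one_half_eq, -one_div, this]
  | succ n ih =>
    have h1 := (measurePreserving_piFinSuccAbove (fun _ : Fin (n+1) => gvec (n+1)) 0).symm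
    have h2 := h1.lintegral_comp (f := fun M => ENNReal.ofReal |(Matrix.of M).det|)
      (meas_det _ (fun M => M) measurable_id).ennreal_ofReal
    change _ = ∫⁻ M, ENNReal.ofReal |(Matrix.of M).det| ∂(stdGaussianMatrix (n+1) (n+1)) at h2
    rw [← h2]
    rw [lintegral_prod _ ((meas_det _ _ h1.measurable).ennreal_ofReal.aemeasurable)]
    have h3 : ∀ g, _ = _ := inner_g n
    simp only [ih] at h3
    have h4 : ∀ (x : Fin (n+1) → ℝ) (y : Fin n → Fin (n+1) → ℝ),
        (MeasurableEquiv.piFinSuccAbove (fun _ : Fin (n+1) => Fin (n+1) → ℝ) 0).symm (x, y)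
          = Fin.cons x y := by
      intro x y
      simp [MeasurableEquiv.piFinSuccAbove_symm_apply, Fin.insertNthEquiv]
    simp only [h4]
    calc _ = ∫⁻ g, _ ∂(gvec (n+1)) := lintegral_congr h3
      _ = _ := by
        rw [lintegral_mul_const _ (by fun_prop), lintegral_norm_gvec,
          ← ENNReal.ofReal_mul (div_nonneg (mul_nonneg (Real.sqrt_nonneg _)
            (Real.Gamma_nonneg_of_nonneg (by positivity))) (Real.Gamma_nonneg_of_nonneg (by positivity)))]
        congr 1
        have : 0 < Real.Gamma (((n:ℝ)+1)/2) := Real.Gamma_pos_of_pos (by positivity)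
        rw [pow_succ, Real.sqrt_mul (by positivity)]
        push_cast
        rw [show (n:ℝ) + 1 + 1 = n + 2 by ring]
        field_simp

/-- For an `n × n` matrix `M` with i.i.d. standard Gaussian entries,
`E |det M| = √(2^n) · Γ((n+1)/2) / √π`. -/
theorem expected_abs_det_gaussian (n : ℕ) :
    ∫ M, |(Matrix.of M).det| ∂(stdGaussianMatrix n n)
      = Real.sqrt (2 ^ n) * Real.Gamma ((n + 1) / 2) / Real.sqrt Real.pi := by
  have : 0 < Real.Gamma (((n:ℝ)+1)/2) := Real.Gamma_pos_of_pos (by positivity)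
  rw [integral_eq_lintegral_of_nonneg_ae (.of_forall fun _ => abs_nonneg _)
    (meas_det _ (fun M => M) measurable_id).aestronglyMeasurable, main_l,
    ENNReal.toReal_ofReal (by positivity)]
end

section
/- Let M ⊂ ℝ^N be an n-dimensional embedded submanifold with x ∈ M, let Π_{N_x M} denote orthogonal projection onto the normal space of M at x, and let φ(A,b) be the standard Gaussian density on ℝ^{n×N} × ℝ^n. Then ∫_{A ∈ ℝ^{n×N}} φ(A, Ax) · |det(A|_{T_x M})| dA = (√(1 + ⟨x, Π_{N_x M} x⟩) / (1 + ‖x‖²)^{(n+1)/2}) · Γ((n+1)/2) / π^{(n+1)/2}. -/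
open Matrix MeasureTheory
open ProbabilityTheory

/-- Rank one perturbation of identity: symmetric square root. -/
theorem exists_sqrt_rank_one {m : ℕ} (v : Fin m → ℝ) (a : ℝ) (h : 0 ≤ 1 + a * (v ⬝ᵥ v)) :
    ∃ R : Matrix (Fin m) (Fin m) ℝ, Rᵀ = R ∧ R * R = 1 + a • vecMulVec v v ∧
      R.det = Real.sqrt (1 + a * (v ⬝ᵥ v)) := by
  set t := Real.sqrt (1 + a * (v ⬝ᵥ v)) with ht
  have ht0 : 0 ≤ t := Real.sqrt_nonneg _
  have ht2 : t * t = 1 + a * (v ⬝ᵥ v) := Real.mul_self_sqrt h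
  have h1 : (1 + t) ≠ 0 := by positivity
  refine ⟨1 + (a / (1 + t)) • vecMulVec v v, ?_, ?_, ?_⟩
  · simp [transpose_vecMulVec]
  · have : vecMulVec v v * vecMulVec v v = (v ⬝ᵥ v) • vecMulVec v v := by
      rw [vecMulVec_mul_vecMulVec]; ext i j; simp [vecMulVec_apply]; ring
    have e : (1 + (a / (1 + t)) • vecMulVec v v) * (1 + (a / (1 + t)) • vecMulVec v v)
      = 1 + (2 * (a / (1 + t)) + (a / (1 + t))^2 * (v ⬝ᵥ v)) • vecMulVec v v := by
      rw [mul_add, add_mul, add_mul, smul_mul_smul, this]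
      simp only [mul_one, one_mul]
      module
    rw [e]; congr 2
    field_simp
    linear_combination (-a) * ht2
  · have : (1 + (a / (1 + t)) • vecMulVec v v) = 1 + replicateCol Unit ((a / (1 + t)) • v) * replicateRow Unit v := by
      ext i j; simp [vecMulVec_apply, Matrix.mul_apply]
    rw [this, det_one_add_replicateCol_mul_replicateRow, dotProduct_smul, smul_eq_mul]
    field_simp
    linear_combination -ht2

theorem exists_householder {m : ℕ} (v : Fin (m+1) → ℝ) :
    ∃ Q : Matrix (Fin (m+1)) (Fin (m+1)) ℝ, Qᵀ = Q ∧ Q * Q = 1 ∧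
      Q *ᵥ v = Pi.single 0 (Real.sqrt (v ⬝ᵥ v)) := by
  set r := Real.sqrt (v ⬝ᵥ v) with hr
  have hvv : 0 ≤ v ⬝ᵥ v := by simp only [dotProduct]; exact Finset.sum_nonneg fun i _ => mul_self_nonneg _
  have hr2 : r * r = v ⬝ᵥ v := Real.mul_self_sqrt hvv
  set u : Fin (m+1) → ℝ := v - Pi.single 0 r with hu
  have huv : u ⬝ᵥ v = r * r - r * v 0 := by
    simp [hu, sub_dotProduct, hr2]
  have huu : u ⬝ᵥ u = 2 * (r * r - r * v 0) := by
    have : u ⬝ᵥ u = u ⬝ᵥ v - u ⬝ᵥ Pi.single 0 r := by rw [← dotProduct_sub]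
    rw [this, huv]; simp [hu]; ring
  by_cases h0 : u = 0
  · refine ⟨1, by simp, by simp, ?_⟩
    rw [one_mulVec]; exact sub_eq_zero.mp h0
  · have hne : u ⬝ᵥ u ≠ 0 := fun h => h0 (dotProduct_self_eq_zero.mp h)
    refine ⟨1 - (2 / (u ⬝ᵥ u)) • vecMulVec u u, ?_, ?_, ?_⟩
    · simp [transpose_vecMulVec]
    · have : vecMulVec u u * vecMulVec u u = (u ⬝ᵥ u) • vecMulVec u u := by
        rw [vecMulVec_mul_vecMulVec]; ext i j; simp [vecMulVec_apply]; ring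
      rw [mul_sub, sub_mul, sub_mul, smul_mul_smul, this, smul_smul]
      simp only [mul_one, one_mul]
      have : 2 / u ⬝ᵥ u * (2 / u ⬝ᵥ u) * u ⬝ᵥ u = 2 * (2 / u ⬝ᵥ u) := by field_simp
      rw [this]; module
    · rw [sub_mulVec, one_mulVec, smul_mulVec, vecMulVec_mulVec]
      have : (2 / u ⬝ᵥ u) • (MulOpposite.op (u ⬝ᵥ v) • u) = u := by
        rw [op_smul_eq_smul, smul_smul]
        have : 2 / u ⬝ᵥ u * u ⬝ᵥ v = 1 := by
          rw [div_mul_eq_mul_div, div_eq_one_iff_eq hne, huv, huu]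
        rw [this, one_smul]
      rw [this, hu]; simp

theorem lintegral_fin_prod_aux {n : ℕ} {E : Type*} [MeasurableSpace E] (μ : Measure E)
    [SigmaFinite μ] (f : Fin n → E → ENNReal) (hf : ∀ i, Measurable (f i)) :
    ∫⁻ x : Fin n → E, ∏ i, f i (x i) ∂(Measure.pi fun _ => μ) = ∏ i, ∫⁻ x, f i x ∂μ := by
  induction n with
  | zero => simp
  | succ n ih =>
    rw [← ((measurePreserving_piFinSuccAbove (fun _ : Fin (n+1) => μ) 0).symm).lintegral_comp_emb
      (MeasurableEquiv.measurableEmbedding _)]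
    simp_rw [MeasurableEquiv.piFinSuccAbove_symm_apply, Fin.insertNthEquiv,
            Fin.prod_univ_succ, Fin.insertNth_zero, Equiv.coe_fn_mk, Fin.cons_succ,
            Fin.cons_zero]
    rw [← ih (fun i => f i.succ) (fun i => hf _)]
    refine lintegral_prod_mul (μ := μ) (ν := Measure.pi fun _ : Fin n => μ) (f := f 0) (g := fun x : Fin n → E => ∏ i, f i.succ (x i)) (hf 0).aemeasurable ?_
    exact (Finset.measurable_prod _ fun i _ => (hf _).comp (measurable_pi_apply i)).aemeasurable

theorem pi_withDensity_aux {n : ℕ} {E : Type*} [MeasurableSpace E] (μ : Measure E)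
    [SigmaFinite μ] (f : E → ENNReal) (hf : Measurable f) [SigmaFinite (μ.withDensity f)] :
    Measure.pi (fun _ : Fin n => μ.withDensity f)
      = (Measure.pi fun _ : Fin n => μ).withDensity (fun x => ∏ i, f (x i)) := by
  classical
  refine (Measure.pi_eq fun s hs => ?_).symm.symm
  rw [withDensity_apply _ (MeasurableSet.univ_pi hs), ← lintegral_indicator (MeasurableSet.univ_pi hs)]
  have : (Set.univ.pi s).indicator (fun x : Fin n → E => ∏ i, f (x i))
      = fun x => ∏ i, (s i).indicator f (x i) := by
    ext x
    by_cases h : x ∈ Set.univ.pi s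
    · rw [Set.indicator_of_mem h]
      exact Finset.prod_congr rfl fun i _ => (Set.indicator_of_mem (h i trivial) f).symm
    · rw [Set.indicator_of_notMem h]
      simp only [Set.mem_pi, Set.mem_univ, true_imp_iff, not_forall] at h
      obtain ⟨i, hi⟩ := h
      exact (Finset.prod_eq_zero (Finset.mem_univ i) (Set.indicator_of_notMem hi f)).symm
  rw [this, lintegral_fin_prod_aux μ _ (fun i => hf.indicator (hs i))]
  exact Finset.prod_congr rfl fun i _ => by rw [withDensity_apply _ (hs i), lintegral_indicator (hs i)]

/-- standard Gaussian on `Fin k → ℝ` -/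
noncomputable def gam (k : ℕ) : Measure (Fin k → ℝ) := Measure.pi fun _ => gaussianReal 0 1

instance (k : ℕ) : IsProbabilityMeasure (gam k) := by unfold gam; infer_instance

theorem gam_eq (k : ℕ) : gam k = (volume : Measure (Fin k → ℝ)).withDensity
    (fun x => ENNReal.ofReal ((2 * Real.pi) ^ (-(k : ℝ) / 2) * Real.exp (-(∑ j, x j ^ 2) / 2))) := by
  have h1 : gaussianReal 0 1 = volume.withDensity (gaussianPDF 0 1) := gaussianReal_of_var_ne_zero _ one_ne_zero
  have : SigmaFinite ((volume : Measure ℝ).withDensity (gaussianPDF 0 1)) := by rw [← h1]; infer_instance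
  unfold gam
  rw [h1, pi_withDensity_aux _ _ (measurable_gaussianPDF 0 1)]
  rw [volume_pi]
  congr 1
  ext x
  simp only [gaussianPDF]
  rw [← ENNReal.ofReal_prod_of_nonneg (fun i _ => gaussianPDFReal_nonneg _ _ _)]
  congr 1
  simp only [gaussianPDFReal, Finset.prod_mul_distrib, ← Real.exp_sum]
  congr 1
  · simp only [NNReal.coe_one, mul_one, Finset.prod_const, Finset.card_univ, Fintype.card_fin]
    rw [Real.sqrt_eq_rpow, ← Real.rpow_neg (by positivity), ← Real.rpow_natCast, ← Real.rpow_mul (by positivity)]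
    congr 1; ring
  · congr 1; simp [Finset.sum_div, neg_div]

theorem pigam_eq (n k : ℕ) : Measure.pi (fun _ : Fin n => gam k) = (volume : Measure (Fin n → Fin k → ℝ)).withDensity
    (fun A => ENNReal.ofReal ((2 * Real.pi) ^ (-((n * k : ℕ) : ℝ) / 2) * Real.exp (-(∑ i, ∑ j, A i j ^ 2) / 2))) := by
  have h1 := gam_eq k
  have : SigmaFinite ((volume : Measure (Fin k → ℝ)).withDensity 
    (fun x => ENNReal.ofReal ((2 * Real.pi) ^ (-(k : ℝ) / 2) * Real.exp (-(∑ j, x j ^ 2) / 2)))) := by rw [← h1]; infer_instance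
  rw [h1, pi_withDensity_aux _ _ (by fun_prop)]
  rw [volume_pi]
  congr 1
  ext x
  rw [← ENNReal.ofReal_prod_of_nonneg (fun i _ => by positivity)]
  congr 1
  simp only [Finset.prod_mul_distrib, ← Real.exp_sum]
  congr 1
  · simp only [Finset.prod_const, Finset.card_univ, Fintype.card_fin]
    rw [← Real.rpow_natCast, ← Real.rpow_mul (by positivity)]
    congr 1; push_cast; ring
  · congr 1; simp [Finset.sum_div, neg_div]

theorem integral_gam (k : ℕ) (f : (Fin k → ℝ) → ℝ) : ∫ x, f x ∂(gam k) =
    ∫ x, (2 * Real.pi) ^ (-(k : ℝ) / 2) * Real.exp (-(∑ j, x j ^ 2) / 2) * f x := by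
  rw [gam_eq, integral_withDensity_eq_integral_toReal_smul (by fun_prop) (by simp)]
  refine integral_congr_ae (Filter.Eventually.of_forall fun x => ?_)
  simp only [smul_eq_mul]
  rw [ENNReal.toReal_ofReal (by positivity)]

theorem integral_pigam (n k : ℕ) (f : (Fin n → Fin k → ℝ) → ℝ) :
    ∫ x, f x ∂(Measure.pi (fun _ : Fin n => gam k)) =
    ∫ A, (2 * Real.pi) ^ (-((n * k : ℕ) : ℝ) / 2) * Real.exp (-(∑ i, ∑ j, A i j ^ 2) / 2) * f A := by
  rw [pigam_eq, integral_withDensity_eq_integral_toReal_smul (by fun_prop) (by simp)]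
  refine integral_congr_ae (Filter.Eventually.of_forall fun x => ?_)
  simp only [smul_eq_mul]
  rw [ENNReal.toReal_ofReal (by positivity)]

theorem charFunDual_gam (k : ℕ) (L : StrongDual ℝ (Fin k → ℝ)) :
    charFunDual (gam k) L = Complex.exp (-((∑ i, L (Pi.single i 1) ^ 2 : ℝ) : ℂ) / 2) := by
  have hL : ∀ v, L v = ∑ i, L (Pi.single i 1) * v i := fun v => by
    conv_lhs => rw [← Finset.univ_sum_single v, map_sum]
    refine Finset.sum_congr rfl fun i _ => ?_
    have : (Pi.single i (v i) : Fin k → ℝ) = v i • Pi.single i 1 := by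
      rw [← Pi.single_smul]; simp
    rw [this, map_smul, smul_eq_mul, mul_comm]
  rw [charFunDual_apply]
  unfold gam
  have : ∀ v : Fin k → ℝ, Complex.exp (L v * Complex.I)
      = ∏ i, Complex.exp ((L (Pi.single i 1) : ℂ) * (v i : ℂ) * Complex.I) := fun v => by
    rw [hL v, ← Complex.exp_sum, ← Finset.sum_mul]; push_cast; rfl
  simp_rw [this]
  rw [integral_fintype_prod_eq_prod (𝕜 := ℂ) (fun i (y : ℝ) => Complex.exp ((L (Pi.single i 1) : ℂ) * (y : ℂ) * Complex.I))]
  simp_rw [← charFun_apply_real, charFun_gaussianReal]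
  rw [← Complex.exp_sum]
  congr 1
  push_cast
  simp [Finset.sum_div, neg_div]

theorem gam_map_eq {m k l : ℕ} (L : Matrix (Fin m) (Fin k) ℝ) (L' : Matrix (Fin m) (Fin l) ℝ)
    (h : L * Lᵀ = L' * L'ᵀ) : (gam k).map (fun v => L *ᵥ v) = (gam l).map (fun v => L' *ᵥ v) := by
  let C : (Fin k → ℝ) →L[ℝ] (Fin m → ℝ) := LinearMap.toContinuousLinearMap (Matrix.mulVecLin L)
  let C' : (Fin l → ℝ) →L[ℝ] (Fin m → ℝ) := LinearMap.toContinuousLinearMap (Matrix.mulVecLin L')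
  change (gam k).map C = (gam l).map C'
  have : IsProbabilityMeasure ((gam k).map C) := Measure.isProbabilityMeasure_map (by fun_prop)
  have : IsProbabilityMeasure ((gam l).map C') := Measure.isProbabilityMeasure_map (by fun_prop)
  refine Measure.ext_of_charFunDual ?_
  ext D
  rw [charFunDual_map, charFunDual_map, charFunDual_gam, charFunDual_gam]
  have key : ∀ (p : ℕ) (M : Matrix (Fin m) (Fin p) ℝ), ∑ i, D (M *ᵥ Pi.single i 1) ^ 2
      = ∑ a, ∑ b, D (Pi.single a 1) * D (Pi.single b 1) * (M * Mᵀ) a b := by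
    intro p M
    have hD : ∀ v, D v = ∑ i, D (Pi.single i 1) * v i := fun v => by
      conv_lhs => rw [← Finset.univ_sum_single v, map_sum]
      refine Finset.sum_congr rfl fun i _ => ?_
      have : (Pi.single i (v i) : Fin m → ℝ) = v i • Pi.single i 1 := by
        rw [← Pi.single_smul]; simp
      rw [this, map_smul, smul_eq_mul, mul_comm]
    have : ∀ i, D (M *ᵥ Pi.single i 1) ^ 2 = ∑ a, ∑ b, D (Pi.single a 1) * D (Pi.single b 1) * (M a i * M b i) := by
      intro i
      rw [hD, sq, Finset.sum_mul_sum]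
      refine Finset.sum_congr rfl fun a _ => Finset.sum_congr rfl fun b _ => ?_
      simp; ring
    simp_rw [this, Matrix.mul_apply, Finset.mul_sum]
    rw [Finset.sum_comm]
    refine Finset.sum_congr rfl fun a _ => ?_
    rw [Finset.sum_comm]
    rfl
  have := (key k L).trans ((by rw [h]) : _ = _) |>.trans (key l L').symm
  congr 4

theorem pigam_integral_eq {p m k l : ℕ} (L : Matrix (Fin m) (Fin k) ℝ) (L' : Matrix (Fin m) (Fin l) ℝ)
    (h : L * Lᵀ = L' * L'ᵀ) (f : (Fin p → Fin m → ℝ) → ENNReal) (hf : Measurable f) :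
    ∫⁻ A, f (fun i => L *ᵥ A i) ∂(Measure.pi fun _ : Fin p => gam k)
     = ∫⁻ A, f (fun i => L' *ᵥ A i) ∂(Measure.pi fun _ : Fin p => gam l) := by
  have hm : ∀ (q : ℕ) (M : Matrix (Fin m) (Fin q) ℝ), Measurable fun v => M *ᵥ v := fun q M =>
    (LinearMap.toContinuousLinearMap (Matrix.mulVecLin M)).continuous.measurable
  have key : ∀ (q : ℕ) (M : Matrix (Fin m) (Fin q) ℝ),
      ∫⁻ A, f (fun i => M *ᵥ A i) ∂(Measure.pi fun _ : Fin p => gam q)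
        = ∫⁻ A, f A ∂(Measure.pi fun _ : Fin p => (gam q).map (fun v => M *ᵥ v)) := by
    intro q M
    have : IsProbabilityMeasure ((gam q).map (fun v => M *ᵥ v)) :=
      Measure.isProbabilityMeasure_map (hm q M).aemeasurable
    rw [← Measure.pi_map_pi (fun i => (hm q M).aemeasurable), lintegral_map hf]
    exact measurable_pi_lambda _ fun i => (hm q M).comp (measurable_pi_apply i)
  rw [key, key, gam_map_eq L L' h]

theorem meas_det_s5 (n : ℕ) : Measurable fun A : Fin n → Fin n → ℝ => ENNReal.ofReal |(Matrix.of A).det| := by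
  have : Continuous fun A : Fin n → Fin n → ℝ => (Matrix.of A).det :=
    Continuous.matrix_det continuous_id
  exact (ENNReal.measurable_ofReal.comp this.abs.measurable)

noncomputable def gaussDet (n : ℕ) : ENNReal :=
  ∫⁻ A, ENNReal.ofReal |(Matrix.of A).det| ∂(Measure.pi fun _ : Fin n => gam n)

theorem inner_J (n : ℕ) (v : Fin (n+1) → ℝ) :
    ∫⁻ B, ENNReal.ofReal |(Matrix.of (Fin.cons v B : Fin (n+1) → Fin (n+1) → ℝ)).det| ∂(Measure.pi fun _ : Fin n => gam (n+1))
      = ENNReal.ofReal (Real.sqrt (v ⬝ᵥ v)) * gaussDet n := by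
  obtain ⟨Q, hQt, hQQ, hQv⟩ := exists_householder v
  have hdet : |Q.det| = 1 := by
    have : Q.det * Q.det = 1 := by rw [← det_mul, hQQ, det_one]
    rw [← sq, sq_eq_one_iff] at this
    rcases this with h | h <;> simp [h]
  let L : Matrix (Fin n) (Fin (n+1)) ℝ := Q.submatrix Fin.succ id
  have hL : L * Lᵀ = (1 : Matrix (Fin n) (Fin n) ℝ) * 1ᵀ := by
    have : L * Lᵀ = (Q * Qᵀ).submatrix Fin.succ Fin.succ := by
      ext i j; simp [L, Matrix.mul_apply]
    rw [this, hQt, hQQ]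
    simp [Matrix.submatrix_one _ (Fin.succ_injective n)]
  have hd : ∀ B : Fin n → Fin (n+1) → ℝ, |(Matrix.of (Fin.cons v B : Fin (n+1) → Fin (n+1) → ℝ)).det|
      = Real.sqrt (v ⬝ᵥ v) * |(Matrix.of fun i => L *ᵥ B i).det| := by
    intro B
    set G := Matrix.of (Fin.cons v B : Fin (n+1) → Fin (n+1) → ℝ) with hG
    have hG0 : G 0 = v := rfl
    have hGs : ∀ i : Fin n, G i.succ = B i := fun _ => rfl
    have e1 : |G.det| = |(G * Q).det| := by rw [det_mul, abs_mul, hdet, mul_one]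
    have e0 : ∀ i j, (G * Q) i j = (Q *ᵥ (G i)) j := by
      intro i j
      conv_lhs => rw [← hQt]
      simp [Matrix.mul_apply, mulVec, dotProduct, mul_comm]
    rw [e1, det_succ_row_zero, Finset.sum_eq_single 0]
    · have : (G * Q) 0 0 = Real.sqrt (v ⬝ᵥ v) := by
        rw [e0, hG0]; simp [hQv]
      rw [this]
      simp only [Fin.val_zero, pow_zero, one_mul, abs_mul, abs_of_nonneg (Real.sqrt_nonneg _)]
      congr 3
      ext i j
      simp only [submatrix_apply, e0, hGs]
      simp [L, mulVec]
    · intro j _ hj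
      have : (G * Q) 0 j = 0 := by
        rw [e0, hG0]; simp [hQv, hj]
      simp [this]
    · simp
  simp_rw [hd, ENNReal.ofReal_mul (Real.sqrt_nonneg _)]
  have hm : Measurable fun B : Fin n → Fin (n+1) → ℝ => fun i => L *ᵥ B i :=
    measurable_pi_lambda _ fun i => ((LinearMap.toContinuousLinearMap (Matrix.mulVecLin L)).continuous.measurable).comp (measurable_pi_apply i)
  have hm2 : Measurable fun B : Fin n → Fin (n+1) → ℝ => ENNReal.ofReal |(Matrix.of fun i => L *ᵥ B i).det| :=
    (meas_det_s5 n).comp hm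
  rw [lintegral_const_mul _ hm2, pigam_integral_eq L 1 hL (fun A => ENNReal.ofReal |(Matrix.of A).det|) (meas_det_s5 n)]
  simp [gaussDet]

theorem gaussDet_succ (n : ℕ) : gaussDet (n+1) = (∫⁻ v, ENNReal.ofReal (Real.sqrt (v ⬝ᵥ v)) ∂(gam (n+1))) * gaussDet n := by
  conv_lhs => unfold gaussDet
  rw [← ((measurePreserving_piFinSuccAbove (fun _ : Fin (n+1) => gam (n+1)) 0).symm).lintegral_comp_emb
      (MeasurableEquiv.measurableEmbedding _)]
  have hm : Measurable fun a : (Fin (n+1) → ℝ) × (Fin n → Fin (n+1) → ℝ) => ENNReal.ofReal |(Matrix.of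
      ((MeasurableEquiv.piFinSuccAbove (fun _ : Fin (n+1) => Fin (n+1) → ℝ) 0).symm a)).det| :=
    (meas_det_s5 (n+1)).comp (MeasurableEquiv.measurable _)
  rw [lintegral_prod _ hm.aemeasurable]
  simp_rw [MeasurableEquiv.piFinSuccAbove_symm_apply, Fin.insertNthEquiv,
            Fin.insertNth_zero, Equiv.coe_fn_mk]
  rw [← lintegral_mul_const _ (by simp only [dotProduct]; fun_prop)]
  exact lintegral_congr fun v => inner_J n v

theorem gam_norm (n : ℕ) : ∫ v, Real.sqrt (v ⬝ᵥ v) ∂(gam (n+1)) =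
    Real.sqrt 2 * Real.Gamma (((n:ℝ) + 2) / 2) / Real.Gamma (((n:ℝ)+1)/2) := by
  rw [integral_gam]
  have h1 : ∀ v : Fin (n+1) → ℝ, v ⬝ᵥ v = ‖(WithLp.toLp 2 v : EuclideanSpace ℝ (Fin (n+1)))‖ ^ 2 := fun v => by
    rw [EuclideanSpace.real_norm_sq_eq]; simp [dotProduct, sq]
  have h2 : ∀ v : Fin (n+1) → ℝ, ∑ j, v j ^ 2 = ‖(WithLp.toLp 2 v : EuclideanSpace ℝ (Fin (n+1)))‖ ^ 2 := fun v => by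
    rw [EuclideanSpace.real_norm_sq_eq]
  simp_rw [h1, h2, Real.sqrt_sq (norm_nonneg _)]
  rw [(PiLp.volume_preserving_toLp (Fin (n+1))).integral_comp (MeasurableEquiv.toLp 2 (Fin (n+1) → ℝ)).measurableEmbedding
    (fun w : EuclideanSpace ℝ (Fin (n+1)) => (2 * Real.pi) ^ (-((n+1 : ℕ) : ℝ) / 2) * Real.exp (-‖w‖ ^ 2 / 2) * ‖w‖)]
  rw [integral_fun_norm_addHaar volume (fun r => (2 * Real.pi) ^ (-((n+1 : ℕ) : ℝ) / 2) * Real.exp (-r ^ 2 / 2) * r)]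
  have h3 : ∫ y in Set.Ioi (0:ℝ), y ^ (Module.finrank ℝ (EuclideanSpace ℝ (Fin (n+1))) - 1) • 
      ((2 * Real.pi) ^ (-((n+1 : ℕ) : ℝ) / 2) * Real.exp (-y ^ 2 / 2) * y)
      = (2 * Real.pi) ^ (-((n+1 : ℕ) : ℝ) / 2) * ((1/2 : ℝ) ^ (-((n+1 : ℝ) + 1) / 2) * (1 / 2) * Real.Gamma (((n + 1:ℝ) + 1) / 2)) := by
    rw [← integral_rpow_mul_exp_neg_mul_rpow (p := 2) (q := n + 1) (b := 1/2) (by norm_num) (by linarith [(Nat.cast_nonneg n : (0:ℝ) ≤ n)]) (by norm_num),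
      ← integral_const_mul]
    refine setIntegral_congr_fun measurableSet_Ioi fun y hy => ?_
    have : y ^ ((n:ℝ)+1) = y ^ (n+1) := by rw [← Real.rpow_natCast]; push_cast; rfl
    simp only [this, finrank_euclideanSpace, Fintype.card_fin, smul_eq_mul, Nat.add_sub_cancel, Real.rpow_two]
    rw [show -y^2/2 = -(1/2)*y^2 by ring]; ring
  rw [h3]
  simp only [Measure.real, EuclideanSpace.volume_ball, finrank_euclideanSpace, Fintype.card_fin, smul_eq_mul, nsmul_eq_mul]
  have hG : 0 < Real.Gamma (((n:ℝ)+1)/2) := Real.Gamma_pos_of_pos (by positivity)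
  have hg : Real.Gamma (((n+1:ℕ):ℝ)/2 + 1) = ((n:ℝ)+1)/2 * Real.Gamma (((n:ℝ)+1)/2) := by
    push_cast; exact Real.Gamma_add_one (by positivity)
  rw [hg]
  simp only [ENNReal.ofReal_one, one_pow, one_mul]
  rw [ENNReal.toReal_ofReal (by positivity)]
  have e1 : √Real.pi ^ (n+1) = Real.pi ^ (((n:ℝ)+1)/2) := by
    rw [Real.sqrt_eq_rpow, ← Real.rpow_natCast, ← Real.rpow_mul Real.pi_pos.le]; congr 1; push_cast; ring
  have e2 : (2 * Real.pi) ^ (-((n+1 : ℕ) : ℝ) / 2) = (2 ^ (((n:ℝ)+1)/2))⁻¹ * (Real.pi ^ (((n:ℝ)+1)/2))⁻¹ := by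
    rw [show -((n+1 : ℕ) : ℝ) / 2 = -(((n:ℝ)+1)/2) by push_cast; ring, Real.rpow_neg (by positivity), Real.mul_rpow (by norm_num) Real.pi_pos.le, mul_inv]
  have e3 : (1/2 : ℝ) ^ (-((n+1 : ℝ) + 1) / 2) = 2 ^ (((n:ℝ)+1)/2) * √2 := by
    rw [one_div, Real.inv_rpow (by norm_num), ← Real.rpow_neg (by norm_num), Real.sqrt_eq_rpow, ← Real.rpow_add (by norm_num)]
    congr 1; ring
  rw [e1, e2, e3, show ((n:ℝ)+1+1)/2 = ((n:ℝ)+2)/2 by ring]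
  have p1 : 0 < Real.pi ^ (((n:ℝ)+1)/2) := by positivity
  have p2 : (0:ℝ) < 2 ^ (((n:ℝ)+1)/2) := by positivity
  push_cast
  field_simp

theorem gaussDet_toReal (n : ℕ) : (gaussDet n).toReal = Real.sqrt 2 ^ n * Real.Gamma (((n:ℝ)+1)/2) / Real.sqrt Real.pi := by
  induction n with
  | zero =>
    simp [gaussDet]
    rw [← one_div, Real.Gamma_one_half_eq, div_self (by positivity)]
  | succ n ih =>
    have : (∫⁻ v, ENNReal.ofReal (Real.sqrt (v ⬝ᵥ v)) ∂(gam (n+1))).toReal = ∫ v, Real.sqrt (v ⬝ᵥ v) ∂(gam (n+1)) := by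
      rw [integral_eq_lintegral_of_nonneg_ae (Filter.Eventually.of_forall fun _ => Real.sqrt_nonneg _)]
      simp only [dotProduct]
      exact Measurable.aestronglyMeasurable (by fun_prop)
    rw [gaussDet_succ, ENNReal.toReal_mul, ih, this, gam_norm]
    have hG : 0 < Real.Gamma (((n:ℝ)+1)/2) := Real.Gamma_pos_of_pos (by positivity)
    push_cast
    rw [show ((n:ℝ)+1+1)/2 = ((n:ℝ)+2)/2 by ring]
    field_simp
    ring

theorem integral_det_mul {n N : ℕ} (K : Matrix (Fin N) (Fin n) ℝ) (R : Matrix (Fin n) (Fin n) ℝ)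
    (hR : Rᵀ = R) (h : Kᵀ * K = R * R) :
    ∫ A, |(Matrix.of A * K).det| ∂(Measure.pi fun _ : Fin n => gam N) = |R.det| * (gaussDet n).toReal := by
  have hc : Continuous fun A : Fin n → Fin N → ℝ => |(Matrix.of A * K).det| :=
    (Continuous.matrix_det (Continuous.matrix_mul (continuous_id : Continuous fun A : Matrix (Fin n) (Fin N) ℝ => A) continuous_const)).abs
  rw [integral_eq_lintegral_of_nonneg_ae (Filter.Eventually.of_forall fun _ => abs_nonneg _)
    hc.aestronglyMeasurable]
  have e1 : ∀ (q : ℕ) (M : Matrix (Fin q) (Fin n) ℝ) (A : Fin n → Fin q → ℝ), Matrix.of A * M = Matrix.of fun i => Mᵀ *ᵥ A i := by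
    intro q M A; ext i j; simp [Matrix.mul_apply, mulVec, dotProduct, mul_comm]
  simp_rw [e1 N K]
  rw [pigam_integral_eq Kᵀ R (by rw [transpose_transpose, h, hR]) (fun A => ENNReal.ofReal |(Matrix.of A).det|) (meas_det_s5 n)]
  have e2 : ∀ A : Fin n → Fin n → ℝ, ENNReal.ofReal |(Matrix.of fun i => R *ᵥ A i).det|
      = ENNReal.ofReal |R.det| * ENNReal.ofReal |(Matrix.of A).det| := by
    intro A
    have := e1 n R A
    rw [hR] at this
    rw [← this, det_mul, abs_mul, mul_comm, ENNReal.ofReal_mul (abs_nonneg _)]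
  simp_rw [e2]
  rw [lintegral_const_mul _ (meas_det_s5 n), ENNReal.toReal_mul, ENNReal.toReal_ofReal (abs_nonneg _)]
  rfl

theorem integral_comp_rows {n N : ℕ} (T : Matrix (Fin N) (Fin N) ℝ) (hT : 0 < T.det)
    (H : (Fin n → Fin N → ℝ) → ℝ) :
    ∫ A : Fin n → Fin N → ℝ, H (fun i => T *ᵥ A i) = (T.det ^ n)⁻¹ * ∫ A, H A := by
  let Φ : (Fin n → Fin N → ℝ) →ₗ[ℝ] (Fin n → Fin N → ℝ) :=
    LinearMap.pi (fun i => (Matrix.toLin' T).comp (LinearMap.proj i))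
  have hdet : LinearMap.det Φ = T.det ^ n := by
    simp only [Φ]
    rw [LinearMap.det_pi]; simp
  have hΦ : LinearMap.det Φ ≠ 0 := by rw [hdet]; positivity
  let Ψ := LinearMap.equivOfDetNeZero Φ hΦ
  have hb : Function.Bijective Φ := Ψ.bijective
  have := integral_image_eq_integral_abs_det_fderiv_smul (volume : Measure (Fin n → Fin N → ℝ))
    (s := Set.univ) MeasurableSet.univ (f := Φ) (f' := fun _ => LinearMap.toContinuousLinearMap Φ)
    (fun x _ => (LinearMap.toContinuousLinearMap Φ).hasFDerivAt.hasFDerivWithinAt) hb.injective.injOn H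
  rw [Set.image_univ, hb.surjective.range_eq] at this
  simp only [Measure.restrict_univ, LinearMap.det_toContinuousLinearMap, smul_eq_mul] at this
  rw [integral_const_mul, hdet, abs_of_pos (by positivity)] at this
  rw [this, inv_mul_cancel_left₀ (by positivity)]
  rfl

/-- Lemma 4.1, the closed form of `α(x)`: for an `n`-dimensional embedded
submanifold `M ⊂ ℝ^N`, `x ∈ M`, `W ∈ ℝ^{N×n}` a matrix whose columns form an orthonormal
basis of the tangent space `T_x M` (so `Π_{N_x M} = 1 − W Wᵀ` and
`|det(A|_{T_x M})| = |det(A W)|`), and `φ` the standard Gaussian density on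
`ℝ^{n×N} × ℝⁿ`:
`∫_A φ(A, Ax)·|det(A|_{T_x M})| dA
   = √(1 + ⟨x, Π_{N_x M} x⟩)/(1+‖x‖²)^{(n+1)/2} · Γ((n+1)/2)/π^{(n+1)/2}`. -/
theorem alpha_closed_form (n N : ℕ) (x : Fin N → ℝ)
    (W : Matrix (Fin N) (Fin n) ℝ) (hW : Wᵀ * W = 1) :
    (∫ A : Fin n → Fin N → ℝ,
        (2 * Real.pi) ^ (-((n * N + n : ℕ) : ℝ) / 2) *
          Real.exp (-((∑ i, ∑ j, A i j ^ 2) +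
            ∑ i, ((Matrix.of A).mulVec x i) ^ 2) / 2) *
          |((Matrix.of A) * W).det|)
      = Real.sqrt (1 + x ⬝ᵥ (1 - W * Wᵀ).mulVec x) /
          (1 + x ⬝ᵥ x) ^ (((n : ℝ) + 1) / 2) *
          (Real.Gamma (((n : ℝ) + 1) / 2) / Real.pi ^ (((n : ℝ) + 1) / 2)) := by
  set s := x ⬝ᵥ x with hs
  have hs0 : 0 ≤ s := by simp only [hs, dotProduct]; exact Finset.sum_nonneg fun i _ => mul_self_nonneg _
  have hr : 0 < 1 + s := by linarith
  set y := Wᵀ *ᵥ x with hy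
  have hP : x ⬝ᵥ (1 - W * Wᵀ).mulVec x = s - y ⬝ᵥ y := by
    rw [sub_mulVec, one_mulVec, dotProduct_sub, ← mulVec_mulVec, dotProduct_mulVec, ← mulVec_transpose]
  have hP0 : 0 ≤ s - y ⬝ᵥ y := by
    have : (x - W *ᵥ y) ⬝ᵥ (x - W *ᵥ y) = s - y ⬝ᵥ y := by
      have a1 : x ⬝ᵥ W *ᵥ y = y ⬝ᵥ y := by rw [dotProduct_mulVec, ← mulVec_transpose]
      have a2 : W *ᵥ y ⬝ᵥ W *ᵥ y = y ⬝ᵥ y := by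
        rw [dotProduct_mulVec, ← mulVec_transpose, mulVec_mulVec, hW, one_mulVec]
      rw [sub_dotProduct, dotProduct_sub, dotProduct_sub, dotProduct_comm (W *ᵥ y) x, a1, a2]; ring
    rw [← this]; simp only [dotProduct]; exact Finset.sum_nonneg fun i _ => mul_self_nonneg _
  obtain ⟨T, hTt, hTT, hTd⟩ := exists_sqrt_rank_one x 1 (by rw [one_mul]; exact hr.le)
  rw [one_mul, ← hs] at hTd
  rw [one_smul] at hTT
  have hq : 1 + (-1 / (1 + s)) * (y ⬝ᵥ y) = (1 + (s - y ⬝ᵥ y)) / (1 + s) := by field_simp; ring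
  obtain ⟨R, hRt, hRR, hRd⟩ := exists_sqrt_rank_one y (-1 / (1 + s)) (by rw [hq]; positivity)
  have hTpos : 0 < T.det := by rw [hTd]; positivity
  have hTu : IsUnit T.det := hTpos.ne'.isUnit
  have hinv : (T * T)⁻¹ = 1 - (1 / (1 + s)) • vecMulVec x x := by
    refine inv_eq_right_inv ?_
    have : vecMulVec x x * vecMulVec x x = s • vecMulVec x x := by
      rw [vecMulVec_mul_vecMulVec]; ext i j; simp [vecMulVec_apply, hs]; ring
    rw [hTT, add_mul, mul_sub, mul_sub, mul_smul_comm, mul_smul_comm, this, smul_smul]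
    simp only [mul_one, one_mul]
    have e : (1 / (1 + s)) * s = 1 - 1 / (1 + s) := by field_simp; ring
    rw [e]; module
  have hK : (T⁻¹ * W)ᵀ * (T⁻¹ * W) = R * R := by
    rw [transpose_mul, transpose_nonsing_inv, hTt, Matrix.mul_assoc, ← Matrix.mul_assoc T⁻¹,
      ← Matrix.mul_inv_rev, hinv, Matrix.sub_mul, Matrix.mul_sub, Matrix.one_mul, hW, hRR]
    have : Wᵀ * ((1 / (1 + s)) • vecMulVec x x * W) = (1 / (1 + s)) • vecMulVec y y := by
      rw [Matrix.smul_mul, Matrix.mul_smul, vecMulVec_mul, mul_vecMulVec, ← mulVec_transpose]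
    rw [this, neg_div, neg_smul, sub_eq_add_neg]
  let H : (Fin n → Fin N → ℝ) → ℝ := fun A =>
    (2 * Real.pi) ^ (-((n * N : ℕ) : ℝ) / 2) * Real.exp (-(∑ i, ∑ j, A i j ^ 2) / 2) *
      |(Matrix.of A * (T⁻¹ * W)).det|
  have hint : ∀ A : Fin n → Fin N → ℝ, (2 * Real.pi) ^ (-((n * N + n : ℕ) : ℝ) / 2) *
          Real.exp (-((∑ i, ∑ j, A i j ^ 2) +
            ∑ i, ((Matrix.of A).mulVec x i) ^ 2) / 2) *
          |((Matrix.of A) * W).det| = (2 * Real.pi) ^ (-(n : ℝ) / 2) * H (fun i => T *ᵥ A i) := by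
    intro A
    have e1 : (Matrix.of fun i => T *ᵥ A i) = Matrix.of A * T := by
      conv_rhs => rw [← hTt]
      ext i j; simp [Matrix.mul_apply, mulVec, dotProduct, mul_comm]
    have e2 : (Matrix.of fun i => T *ᵥ A i) * (T⁻¹ * W) = Matrix.of A * W := by
      rw [e1, Matrix.mul_assoc, ← Matrix.mul_assoc T, Matrix.mul_nonsing_inv _ hTu, Matrix.one_mul]
    have e3 : ∀ i, ∑ j, (T *ᵥ A i) j ^ 2 = ∑ j, A i j ^ 2 + ((Matrix.of A).mulVec x i) ^ 2 := by
      intro i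
      have b1 : ∑ j, (T *ᵥ A i) j ^ 2 = (T *ᵥ A i) ⬝ᵥ (T *ᵥ A i) := by simp [dotProduct, sq]
      have b2 : ∑ j, A i j ^ 2 = A i ⬝ᵥ A i := by simp [dotProduct, sq]
      have b3 : (Matrix.of A).mulVec x i = A i ⬝ᵥ x := rfl
      rw [b1, b2, b3, dotProduct_mulVec, ← mulVec_transpose, hTt, mulVec_mulVec, hTT, add_mulVec,
        one_mulVec, add_dotProduct, vecMulVec_mulVec, op_smul_eq_smul, smul_dotProduct, smul_eq_mul,
        dotProduct_comm x (A i), sq]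
    simp only [H]
    rw [e2]
    simp_rw [e3]
    rw [Finset.sum_add_distrib]
    have e4 : (2 * Real.pi) ^ (-((n * N + n : ℕ) : ℝ) / 2)
        = (2 * Real.pi) ^ (-(n : ℝ) / 2) * (2 * Real.pi) ^ (-((n * N : ℕ) : ℝ) / 2) := by
      rw [← Real.rpow_add (by positivity)]; congr 1; push_cast; ring
    rw [e4]; ring
  simp_rw [hint]
  rw [integral_const_mul, integral_comp_rows T hTpos H]
  simp only [H]
  rw [← integral_pigam n N (fun A => |(Matrix.of A * (T⁻¹ * W)).det|), integral_det_mul _ R hRt hK,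
    gaussDet_toReal, hRd, hTd, hq, hP, abs_of_nonneg (Real.sqrt_nonneg _), Real.sqrt_div (by positivity)]
  have c1 : √(1 + s) ^ n * √(1 + s) = (1 + s) ^ (((n : ℝ) + 1) / 2) := by
    rw [← pow_succ, Real.sqrt_eq_rpow, ← Real.rpow_natCast, ← Real.rpow_mul hr.le]
    congr 1; push_cast; ring
  have c2 : √Real.pi ^ n * √Real.pi = Real.pi ^ (((n : ℝ) + 1) / 2) := by
    rw [← pow_succ, Real.sqrt_eq_rpow, ← Real.rpow_natCast, ← Real.rpow_mul Real.pi_pos.le]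
    congr 1; push_cast; ring
  have c3 : (2 * Real.pi) ^ (-(n : ℝ) / 2) = (√2 ^ n * √Real.pi ^ n)⁻¹ := by
    rw [← mul_pow, ← Real.sqrt_mul (by norm_num), Real.sqrt_eq_rpow, ← Real.rpow_natCast,
      ← Real.rpow_mul (by positivity), ← Real.rpow_neg (by positivity)]
    congr 1; ring
  rw [← c1, ← c2, c3]
  have d1 : 0 < √(1 + s) := by positivity
  have d2 : 0 < √Real.pi := by positivity
  field_simp
end
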